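/- Let σ be a finite positive Borel measure on ℝ with support contained in [α,β] and σ(ℝ) > 0, let φ be its Markov function, and let z ∈ ℂ with Im z > 0. Then there exist real numbers a⁽¹⁾, a⁽²⁾, a real number b > 0, and a finite positive Borel measure μ on ℝ with support contained in [α,β] (possibly the zero measure) such that, with τ(λ) = ∫ dμ(t)/(t − λ), for every λ ∈ ℂ with Im λ > 0 one has a⁽²⁾λ − a⁽¹⁾ + b²(λ − z)(λ − conj(z))τ(λ) ≠ 0 and φ(λ) = −1/(a⁽²⁾λ − a⁽¹⁾ + b²(λ − z)(λ − conj(z))τ(λ)). -/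

import Mathlib

open MeasureTheory
open scoped CompactlySupported InnerProductSpace

theorem exists_spectral_measure {H : Type*} [NormedAddCommGroup H] [InnerProductSpace ℂ H]
    [CompleteSpace H] {α β : ℝ} (B : H →L[ℂ] H) (hB : IsSelfAdjoint B)
    (hspec : spectrum ℝ B ⊆ Set.Icc α β) (v : H) :
    ∃ ρ : Measure ℝ, IsFiniteMeasure ρ ∧ ρ (Set.Icc α β)ᶜ = 0 ∧
      ∀ f : ℝ → ℝ, Continuous f → ((∫ t, f t ∂ρ : ℝ) : ℂ) = ⟪v, cfc f B v⟫_ℂ := by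
  have : CompactSpace (spectrum ℝ B) := isCompact_iff_compactSpace.mp (spectrum.isCompact B)
  let Λ₀ : C_c(spectrum ℝ B, ℝ) →ₗ[ℝ] ℝ :=
    { toFun := fun f => (⟪v, cfcHom hB f.toContinuousMap v⟫_ℂ).re
      map_add' := fun f g => by
        have : (f + g).toContinuousMap = f.toContinuousMap + g.toContinuousMap := rfl
        rw [this, map_add, add_apply, inner_add_right, Complex.add_re]
      map_smul' := fun c f => by
        have : (c • f).toContinuousMap = c • f.toContinuousMap := rfl
        rw [this, map_smul, smul_apply, ← Complex.coe_smul, inner_smul_right,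
          Complex.re_ofReal_mul, RingHom.id_apply, smul_eq_mul] }
  let Λ : C_c(spectrum ℝ B, ℝ) →ₚ[ℝ] ℝ := PositiveLinearMap.mk₀ Λ₀ (fun f hf => by
    have h : 0 ≤ cfcHom hB f.toContinuousMap := cfcHom_nonneg_iff hB |>.2 fun x => hf x
    exact (((ContinuousLinearMap.nonneg_iff_isPositive _).1 h).re_inner_nonneg_right v))
  have hfin : IsFiniteMeasure (RealRMK.rieszMeasure Λ) :=
    ⟨isCompact_univ.measure_lt_top⟩
  refine ⟨(RealRMK.rieszMeasure Λ).map Subtype.val, inferInstance, ?_, fun f hf => ?_⟩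
  · rw [Measure.map_apply measurable_subtype_coe measurableSet_Icc.compl]
    convert! measure_empty (μ := RealRMK.rieszMeasure Λ)
    ext x
    simpa using hspec x.2
  · rw [integral_map measurable_subtype_coe.aemeasurable hf.aestronglyMeasurable]
    let g : C_c(spectrum ℝ B, ℝ) := CompactlySupportedContinuousMap.continuousMapEquiv
      ⟨_, hf.continuousOn.domRestrict (s := spectrum ℝ B)⟩
    have h := RealRMK.integral_rieszMeasure Λ g
    have h' : Λ g = (⟪v, cfc f B v⟫_ℂ).re := by
      rw [cfc_apply f B hB hf.continuousOn]; rfl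
    have h2 : IsSelfAdjoint (cfc f B) := cfc_predicate f B
    have h3 : ((⟪v, cfc f B v⟫_ℂ).re : ℂ) = ⟪v, cfc f B v⟫_ℂ :=
      h2.isSymmetric.coe_re_inner_self_apply v
    rw [← h3, ← h', ← h]
    rfl

theorem Continuous.integrable_of_measure_compl_Icc_eq_zero {E : Type*} [NormedAddCommGroup E]
    {α β : ℝ} {ρ : Measure ℝ} [IsFiniteMeasure ρ] (hρ : ρ (Set.Icc α β)ᶜ = 0) {f : ℝ → E}
    (hf : Continuous f) : Integrable f ρ := by
  rw [← Measure.restrict_eq_self_of_ae_mem (μ := ρ) (s := Set.Icc α β) (ae_iff.2 hρ)]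
  exact hf.continuousOn.integrableOn_compact isCompact_Icc

theorem ofReal_sub_ne_zero_of_im_pos {lam : ℂ} (hlam : 0 < lam.im) (t : ℝ) : (t : ℂ) - lam ≠ 0 := by
  intro h
  have := congrArg Complex.im h
  simp only [Complex.sub_im, Complex.ofReal_im, zero_sub, Complex.zero_im, neg_eq_zero] at this
  exact hlam.ne' this

theorem continuous_one_div_ofReal_sub {lam : ℂ} (hlam : 0 < lam.im) :
    Continuous fun t : ℝ => 1 / ((t : ℂ) - lam) :=
  continuous_const.div (by fun_prop) (ofReal_sub_ne_zero_of_im_pos hlam)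

theorem cfc_mul_self {H : Type*} [NormedAddCommGroup H] [InnerProductSpace ℂ H]
    [CompleteSpace H] (B : H →L[ℂ] H) (hB : IsSelfAdjoint B) {f : ℝ → ℝ} (hf : Continuous f) :
    cfc (fun t => f t * t) B = cfc f B * B := by
  rw [cfc_mul f (fun t => t) B hf.continuousOn continuousOn_id, cfc_id' ℝ B hB]

theorem exists_measure_resolvent {H : Type*} [NormedAddCommGroup H] [InnerProductSpace ℂ H]
    [CompleteSpace H] {α β : ℝ} (B : H →L[ℂ] H) (hB : IsSelfAdjoint B)
    (hspec : spectrum ℝ B ⊆ Set.Icc α β) (v : H) :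
    ∃ ρ : Measure ℝ, IsFiniteMeasure ρ ∧ ρ (Set.Icc α β)ᶜ = 0 ∧
      ∀ (lam : ℂ) (c : ℂ) (w : H), 0 < lam.im → B w - lam • w = c • v →
        ⟪v, w⟫_ℂ = c * ∫ t, 1 / ((t : ℂ) - lam) ∂ρ := by
  obtain ⟨ρ, hfin, hsupp, h⟩ := exists_spectral_measure B hB hspec v
  refine ⟨ρ, hfin, hsupp, fun lam c w hlam hw => ?_⟩
  set F : ℝ → ℝ := fun t => (1 / ((t : ℂ) - lam)).re
  set G : ℝ → ℝ := fun t => (1 / ((t : ℂ) - lam)).im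
  have hc := continuous_one_div_ofReal_sub hlam
  have hFc : Continuous F := Complex.continuous_re.comp hc
  have hGc : Continuous G := Complex.continuous_im.comp hc
  have hFG : ∀ t : ℝ, 1 / ((t : ℂ) - lam) * t = 1 + lam * (1 / ((t : ℂ) - lam)) := fun t => by
    have := ofReal_sub_ne_zero_of_im_pos hlam t
    field_simp
    ring
  have hFt : ∀ t, F t * t = 1 + lam.re * F t - lam.im * G t := fun t => by
    have := congrArg Complex.re (hFG t)
    rw [Complex.re_mul_ofReal, Complex.add_re, Complex.one_re, Complex.mul_re] at this
    linarith
  have hGt : ∀ t, G t * t = lam.re * G t + lam.im * F t := fun t => by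
    have := congrArg Complex.im (hFG t)
    rw [Complex.im_mul_ofReal, Complex.add_im, Complex.one_im, Complex.mul_im] at this
    linarith
  have hsplit : ∫ t, 1 / ((t : ℂ) - lam) ∂ρ =
      ((∫ t, F t ∂ρ : ℝ) : ℂ) + Complex.I * ((∫ t, G t ∂ρ : ℝ) : ℂ) := by
    rw [mul_comm]
    exact (integral_re_add_im (hc.integrable_of_measure_compl_Icc_eq_zero hsupp)).symm
  clear_value F G
  have hFB : cfc F B * B = 1 + lam.re • cfc F B - lam.im • cfc G B := by
    rw [← cfc_mul_self B hB hFc, funext hFt,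
      cfc_sub (fun t => 1 + lam.re * F t) (fun t => lam.im * G t) B (by fun_prop) (by fun_prop),
      cfc_add B (fun _ => 1) (fun t => lam.re * F t) (by fun_prop) (by fun_prop),
      cfc_const_mul _ F B (by fun_prop), cfc_const_mul _ G B (by fun_prop), cfc_const_one ℝ B hB]
  have hGB : cfc G B * B = lam.re • cfc G B + lam.im • cfc F B := by
    rw [← cfc_mul_self B hB hGc, funext hGt,
      cfc_add B (fun t => lam.re * G t) (fun t => lam.im * F t) (by fun_prop) (by fun_prop),
      cfc_const_mul _ F B (by fun_prop), cfc_const_mul _ G B (by fun_prop)]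
  have hw' : w = c • (cfc F B v + Complex.I • cfc G B v) := by
    have h1 : cfc F B (B w) = w + (lam.re : ℂ) • cfc F B w - (lam.im : ℂ) • cfc G B w := by
      simpa using congrArg (fun T : H →L[ℂ] H => T w) hFB
    have h2 : cfc G B (B w) = (lam.re : ℂ) • cfc G B w + (lam.im : ℂ) • cfc F B w := by
      simpa using congrArg (fun T : H →L[ℂ] H => T w) hGB
    rw [smul_add, smul_comm c Complex.I, ← map_smul, ← map_smul (cfc G B), ← hw, map_sub, map_sub,
      map_smul, map_smul, h1, h2]
    have hl := Complex.re_add_im lam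
    match_scalars
    · ring
    · linear_combination -hl
    · linear_combination -Complex.I * hl + lam.im * Complex.I_sq
  rw [hw', inner_smul_right, inner_add_right, inner_smul_right, ← h F hFc, ← h G hGc, hsplit]

theorem compression_sub_algebraMap {R : Type*} [Ring R] [Algebra ℝ R] {P : R}
    (hP : IsIdempotentElem P) (A : R) (α r : ℝ) :
    P * A * P + α • (1 - P) - algebraMap ℝ R r =
      P * (A - algebraMap ℝ R r) * P + (α - r) • (1 - P) := by
  simp only [Algebra.algebraMap_eq_smul_one, mul_sub, sub_mul, mul_smul_comm, smul_mul_assoc,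
    mul_one, hP.eq]
  module

theorem spectrum_compression_subset_Icc {H : Type*} [NormedAddCommGroup H] [InnerProductSpace ℂ H]
    [CompleteSpace H] {α β : ℝ} (hαβ : α ≤ β) {A P : H →L[ℂ] H} (hA : IsSelfAdjoint A)
    (hαA : algebraMap ℝ _ α ≤ A) (hAβ : A ≤ algebraMap ℝ _ β) (hP : IsStarProjection P) :
    IsSelfAdjoint (P * A * P + α • (1 - P)) ∧
      spectrum ℝ (P * A * P + α • (1 - P)) ⊆ Set.Icc α β := by
  have hB : IsSelfAdjoint (P * A * P + α • (1 - P)) :=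
    (hA.conjugate_self hP.isSelfAdjoint).add (.smul (.all α) hP.one_sub.isSelfAdjoint)
  refine ⟨hB, fun x hx => ⟨(algebraMap_le_iff_le_spectrum hB).1 ?_ x hx,
    (le_algebraMap_iff_spectrum_le hB).1 ?_ x hx⟩⟩
  · rw [← sub_nonneg, compression_sub_algebraMap hP.isIdempotentElem, sub_self, zero_smul, add_zero]
    exact hP.isSelfAdjoint.conjugate_nonneg (sub_nonneg.2 hαA)
  · rw [← sub_nonneg, ← neg_sub, compression_sub_algebraMap hP.isIdempotentElem, neg_add,
      ← neg_mul, ← mul_neg, neg_sub, ← neg_smul, neg_sub]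
    exact add_nonneg (hP.isSelfAdjoint.conjugate_nonneg (sub_nonneg.2 hAβ))
      (smul_nonneg (sub_nonneg.2 hαβ) hP.one_sub.nonneg)

theorem exists_measure_compression {H : Type*} [NormedAddCommGroup H] [InnerProductSpace ℂ H]
    [CompleteSpace H] {α β : ℝ} (hαβ : α ≤ β) (A : H →L[ℂ] H) (hA : IsSelfAdjoint A)
    (hαA : algebraMap ℝ _ α ≤ A) (hAβ : A ≤ algebraMap ℝ _ β) (e : H) :
    ∃ ρ : Measure ℝ, IsFiniteMeasure ρ ∧ ρ (Set.Icc α β)ᶜ = 0 ∧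
      ∀ (lam : ℂ) (u : H), 0 < lam.im → A u - lam • u = e →
        ⟪e, u⟫_ℂ * (lam * ⟪e, e⟫_ℂ - ⟪e, A e⟫_ℂ + ∫ t, 1 / ((t : ℂ) - lam) ∂ρ) =
          -⟪e, e⟫_ℂ ^ 2 := by
  set Q : H →L[ℂ] H := (ℂ ∙ e).starProjection with hQ
  have hQp : IsStarProjection Q := isStarProjection_starProjection
  have hPp : IsStarProjection (1 - Q) := hQp.one_sub
  set P : H →L[ℂ] H := 1 - Q with hP
  have hPQ : Q = 1 - P := by rw [hP, sub_sub_cancel]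
  have hPP : P * P = P := hPp.isIdempotentElem
  obtain ⟨hB, hspec⟩ := spectrum_compression_subset_Icc hαβ hA hαA hAβ hPp
  rw [← hPQ] at hB hspec
  set B : H →L[ℂ] H := P * A * P + α • Q with hBdef
  obtain ⟨ρ, hfin, hsupp, h⟩ := exists_measure_resolvent B hB hspec (P (A e))
  refine ⟨ρ, hfin, hsupp, fun lam u hlam hu => ?_⟩
  have hPe : P e = 0 := by
    rw [hP, sub_apply, hQ,
      Submodule.starProjection_eq_self_iff.2 (Submodule.mem_span_singleton_self e)]
    exact sub_self e
  have hQu : ⟪e, e⟫_ℂ • Q u = ⟪e, u⟫_ℂ • e := by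
    rw [inner_self_eq_norm_sq_to_K]
    exact_mod_cast Submodule.smul_starProjection_singleton ℂ (v := e) u
  have hsymm : ∀ x y, ⟪P x, y⟫_ℂ = ⟪x, P y⟫_ℂ := hPp.isSelfAdjoint.isSymmetric
  have hAsymm : ∀ x y, ⟪A x, y⟫_ℂ = ⟪x, A y⟫_ℂ := hA.isSymmetric
  have hPPx : ∀ x, P (P x) = P x := fun x => congrArg (fun T : H →L[ℂ] H => T x) hPP
  have hQP : ∀ x, Q (P x) = 0 := fun x => by
    rw [hPQ, sub_apply, hPPx]
    simp
  have hu' : ⟪e, e⟫_ℂ • P u = ⟪e, e⟫_ℂ • u - ⟪e, u⟫_ℂ • e := by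
    rw [← hQu, ← smul_sub, hP]
    simp
  have hBw : B (⟪e, e⟫_ℂ • P u) - lam • ⟪e, e⟫_ℂ • P u = (-⟪e, u⟫_ℂ) • P (A e) := by
    have h1 : B (P u) = P (A (P u)) := by simp [hBdef, hPPx, hQP]
    have h2 : P (A u) = lam • P u := by
      rw [sub_eq_iff_eq_add.1 hu, map_add, hPe, zero_add, map_smul]
    have h3 : ⟪e, e⟫_ℂ • P (A (P u)) = ⟪e, e⟫_ℂ • lam • P u - ⟪e, u⟫_ℂ • P (A e) := by
      rw [← map_smul, ← map_smul, hu']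
      simp only [map_sub, map_smul, h2]
    rw [map_smul, h1, h3]
    module
  have h1 := h lam _ _ hlam hBw
  rw [hsymm, map_smul, hPPx, hu', inner_sub_right, inner_smul_right, inner_smul_right, hAsymm,
    hAsymm] at h1
  have h2 : ⟪e, A u⟫_ℂ = ⟪e, e⟫_ℂ + lam * ⟪e, u⟫_ℂ := by
    rw [← inner_smul_right, ← inner_add_right, ← sub_eq_iff_eq_add.1 hu]
  rw [h2] at h1
  linear_combination h1

theorem algebraMap_le_of_le_re_inner {H : Type*} [NormedAddCommGroup H] [InnerProductSpace ℂ H]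
    [CompleteSpace H] {A : H →L[ℂ] H} (hA : IsSelfAdjoint A) {r : ℝ}
    (h : ∀ f, r * ‖f‖ ^ 2 ≤ (⟪A f, f⟫_ℂ).re) : algebraMap ℝ _ r ≤ A := by
  have hr : IsSelfAdjoint (algebraMap ℝ (H →L[ℂ] H) r) := .algebraMap _ (.all r)
  rw [ContinuousLinearMap.le_def, ContinuousLinearMap.isPositive_def]
  refine ⟨(hA.sub hr).isSymmetric, fun f => ?_⟩
  have hf : algebraMap ℝ (H →L[ℂ] H) r f = (r : ℂ) • f := by simp [Algebra.algebraMap_eq_smul_one]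
  rw [ContinuousLinearMap.reApplyInnerSelf_apply, sub_apply, hf, inner_sub_left, inner_smul_left,
    inner_self_eq_norm_sq_to_K]
  simpa [← Complex.ofReal_pow] using h f

theorem le_algebraMap_of_re_inner_le {H : Type*} [NormedAddCommGroup H] [InnerProductSpace ℂ H]
    [CompleteSpace H] {A : H →L[ℂ] H} (hA : IsSelfAdjoint A) {r : ℝ}
    (h : ∀ f, (⟪A f, f⟫_ℂ).re ≤ r * ‖f‖ ^ 2) : A ≤ algebraMap ℝ _ r := by
  rw [← neg_le_neg_iff, ← map_neg]
  exact algebraMap_le_of_le_re_inner hA.neg fun f => by simpa using h f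

theorem exists_mul_operator {α β : ℝ} (σ : Measure ℝ) (hσ : σ (Set.Icc α β)ᶜ = 0) :
    ∃ A : Lp ℂ 2 σ →L[ℂ] Lp ℂ 2 σ, IsSelfAdjoint A ∧ algebraMap ℝ _ α ≤ A ∧
      A ≤ algebraMap ℝ _ β ∧ ∀ f : Lp ℂ 2 σ, A f =ᵐ[σ] fun t => (t : ℂ) * f t := by
  have hmem : ∀ᵐ t ∂σ, t ∈ Set.Icc α β := ae_iff.2 hσ
  have hbdd : MemLp (fun t : ℝ => (t : ℂ)) ⊤ σ := by
    refine memLp_top_of_bound (by fun_prop) (max |α| |β|) ?_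
    filter_upwards [hmem] with t ht
    rw [Complex.norm_real]
    exact abs_le_max_abs_abs ht.1 ht.2
  let A : Lp ℂ 2 σ →L[ℂ] Lp ℂ 2 σ := (ContinuousLinearMap.mul ℂ ℂ).holderL σ ⊤ 2 2 hbdd.toLp
  have hA : ∀ f : Lp ℂ 2 σ, A f =ᵐ[σ] fun t => (t : ℂ) * f t := fun f => by
    have h := (ContinuousLinearMap.mul ℂ ℂ).coeFn_holder (r := 2) hbdd.toLp f
    filter_upwards [h, hbdd.coeFn_toLp] with t h1 h2
    rw [h2] at h1
    exact h1
  have hself : IsSelfAdjoint A := by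
    refine ContinuousLinearMap.isSelfAdjoint_iff_isSymmetric.2 fun f g => ?_
    simp only [ContinuousLinearMap.coe_coe, L2.inner_def]
    refine integral_congr_ae ?_
    filter_upwards [hA f, hA g] with t hf hg
    simp [hf, hg]
    ring
  have hre : ∀ f : Lp ℂ 2 σ, (⟪A f, f⟫_ℂ).re = ∫ t, t * ‖f t‖ ^ 2 ∂σ := fun f => by
    rw [L2.inner_def]
    refine (integral_re (𝕜 := ℂ) (L2.integrable_inner _ f)).symm.trans (integral_congr_ae ?_)
    filter_upwards [hA f] with t ht
    rw [ht, ← smul_eq_mul, inner_smul_left, inner_self_eq_norm_sq_to_K]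
    simp [← Complex.ofReal_pow]
  have hnorm : ∀ f : Lp ℂ 2 σ, ‖f‖ ^ 2 = ∫ t, ‖f t‖ ^ 2 ∂σ := fun f => by
    rw [← inner_self_eq_norm_sq (𝕜 := ℂ) f, L2.inner_def]
    refine (integral_re (𝕜 := ℂ) (L2.integrable_inner f f)).symm.trans (integral_congr_ae ?_)
    exact .of_forall fun t => inner_self_eq_norm_sq (𝕜 := ℂ) (f t)
  have hint : ∀ f : Lp ℂ 2 σ, Integrable (fun t => ‖f t‖ ^ 2) σ := fun f =>
    (memLp_two_iff_integrable_sq_norm (Lp.aestronglyMeasurable f)).1 (Lp.memLp f)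
  have hint' : ∀ f : Lp ℂ 2 σ, Integrable (fun t => t * ‖f t‖ ^ 2) σ := fun f => by
    refine (L2.integrable_inner (𝕜 := ℂ) (A f) f).re.congr ?_
    filter_upwards [hA f] with t ht
    rw [ht, ← smul_eq_mul, inner_smul_left, inner_self_eq_norm_sq_to_K]
    simp [← Complex.ofReal_pow]
  refine ⟨A, hself, algebraMap_le_of_le_re_inner hself fun f => ?_,
    le_algebraMap_of_re_inner_le hself fun f => ?_, hA⟩
  · rw [hre, hnorm, ← integral_const_mul]
    refine integral_mono_ae ((hint f).const_mul _) (hint' f) ?_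
    filter_upwards [hmem] with t ht
    exact mul_le_mul_of_nonneg_right ht.1 (sq_nonneg _)
  · rw [hre, hnorm, ← integral_const_mul]
    refine integral_mono_ae (hint' f) ((hint f).const_mul _) ?_
    filter_upwards [hmem] with t ht
    exact mul_le_mul_of_nonneg_right ht.2 (sq_nonneg _)

/-- The negative reciprocal of a Markov function is, up to scaling, an affine function plus a
Markov function. -/
theorem exists_measure_markov_mul {α β : ℝ} (hαβ : α ≤ β) (σ : Measure ℝ) [IsFiniteMeasure σ]
    (hσ : σ (Set.Icc α β)ᶜ = 0) :
    ∃ (s : ℝ) (ρ : Measure ℝ), IsFiniteMeasure ρ ∧ ρ (Set.Icc α β)ᶜ = 0 ∧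
      ∀ lam : ℂ, 0 < lam.im →
        (∫ t, 1 / ((t : ℂ) - lam) ∂σ) *
          (lam * σ.real Set.univ - s + ∫ t, 1 / ((t : ℂ) - lam) ∂ρ) = -(σ.real Set.univ : ℂ) ^ 2 := by
  obtain ⟨A, hA, hαA, hAβ, hAf⟩ := exists_mul_operator σ hσ
  have h1 : MemLp (fun _ : ℝ => (1 : ℂ)) 2 σ := memLp_const 1
  set e : Lp ℂ 2 σ := h1.toLp with he
  have hinner : ∀ f : Lp ℂ 2 σ, ⟪e, f⟫_ℂ = ∫ t, f t ∂σ := fun f => by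
    rw [L2.inner_def]
    refine integral_congr_ae ?_
    filter_upwards [h1.coeFn_toLp] with t ht
    rw [he, ht]
    simp
  have hee : ⟪e, e⟫_ℂ = σ.real Set.univ := by
    rw [hinner, integral_congr_ae h1.coeFn_toLp]
    simp
  have hs : ((⟪e, A e⟫_ℂ).re : ℂ) = ⟪e, A e⟫_ℂ := hA.isSymmetric.coe_re_inner_self_apply e
  obtain ⟨ρ, hfin, hsupp, h⟩ := exists_measure_compression hαβ A hA hαA hAβ e
  refine ⟨(⟪e, A e⟫_ℂ).re, ρ, hfin, hsupp, fun lam hlam => ?_⟩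
  have hc := continuous_one_div_ofReal_sub hlam
  have h2 : MemLp (fun t : ℝ => 1 / ((t : ℂ) - lam)) 2 σ := by
    rw [memLp_two_iff_integrable_sq_norm hc.aestronglyMeasurable]
    exact (hc.norm.pow 2).integrable_of_measure_compl_Icc_eq_zero hσ
  have hu : A h2.toLp - lam • h2.toLp = e := by
    refine Lp.ext ?_
    filter_upwards [Lp.coeFn_sub (A h2.toLp) (lam • h2.toLp), Lp.coeFn_smul lam h2.toLp,
      hAf h2.toLp, h1.coeFn_toLp, h2.coeFn_toLp] with t h3 h4 h5 h6 h7
    rw [h3, Pi.sub_apply, h4, Pi.smul_apply, h5, h7, he, h6, smul_eq_mul, ← sub_mul,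
      mul_one_div_cancel (ofReal_sub_ne_zero_of_im_pos hlam t)]
  have h8 := h lam _ hlam hu
  rwa [hinner, integral_congr_ae h2.coeFn_toLp, hee, ← hs] at h8

/-- Division of a finite measure on an interval by the weight `|t - z|²`. -/
theorem exists_measure_markov_eq {α β : ℝ} (ρ : Measure ℝ) [IsFiniteMeasure ρ]
    (hρ : ρ (Set.Icc α β)ᶜ = 0) {z : ℂ} (hz : 0 < z.im) :
    ∃ (c d : ℝ) (μ : Measure ℝ), IsFiniteMeasure μ ∧ μ (Set.Icc α β)ᶜ = 0 ∧
      ∀ lam : ℂ, 0 < lam.im →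
        ∫ t, 1 / ((t : ℂ) - lam) ∂ρ =
          c * lam - d + (lam - z) * (lam - (starRingEnd ℂ) z) * ∫ t, 1 / ((t : ℂ) - lam) ∂μ := by
  set N : ℝ → NNReal := fun t => ‖1 / ((t : ℂ) - z)‖₊ ^ 2 with hN
  have hNc : Continuous N := (continuous_one_div_ofReal_sub hz).nnnorm.pow 2
  have hNi : Integrable (fun t => (N t : ℝ)) ρ :=
    (NNReal.continuous_coe.comp hNc).integrable_of_measure_compl_Icc_eq_zero hρ
  have hNval : ∀ t : ℝ, ((N t : ℝ) : ℂ) * (((t : ℂ) - z) * ((t : ℂ) - (starRingEnd ℂ) z)) = 1 := by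
    intro t
    have h0 := ofReal_sub_ne_zero_of_im_pos hz t
    have h1 : ((t : ℂ) - (starRingEnd ℂ) z) = (starRingEnd ℂ) ((t : ℂ) - z) := by simp
    rw [h1, Complex.mul_conj, ← Complex.ofReal_mul, Complex.normSq_eq_norm_sq]
    have h2 := norm_ne_zero_iff.2 h0
    simp only [hN, NNReal.coe_pow, coe_nnnorm, norm_div, norm_one]
    field_simp
    simp
  set μ : Measure ℝ := ρ.withDensity fun t => (N t : ENNReal) with hμdef
  have hμ : μ (Set.Icc α β)ᶜ = 0 := withDensity_absolutelyContinuous _ _ hρ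
  have hfin : IsFiniteMeasure μ := by
    have := hNi.lintegral_lt_top
    refine isFiniteMeasure_withDensity ?_
    simpa using this.ne
  have hint : ∀ f : ℝ → ℂ, ∫ t, f t ∂μ = ∫ t, ((N t : ℝ) : ℂ) * f t ∂ρ := fun f => by
    rw [hμdef, integral_withDensity_eq_integral_smul hNc.measurable]
    rfl
  refine ⟨μ.real Set.univ, 2 * z.re * μ.real Set.univ - ∫ t, t ∂μ, μ, hfin, hμ, fun lam hlam => ?_⟩
  have hc := continuous_one_div_ofReal_sub hlam
  have hi := hc.integrable_of_measure_compl_Icc_eq_zero hμ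
  have hid : Integrable (fun t : ℝ => (t : ℂ)) μ :=
    Complex.continuous_ofReal.integrable_of_measure_compl_Icc_eq_zero hμ
  have hkey : ∀ t : ℝ, 1 / ((t : ℂ) - lam) = ((N t : ℝ) : ℂ) * ((t : ℂ) + (lam - 2 * z.re) +
      (lam - z) * (lam - (starRingEnd ℂ) z) * (1 / ((t : ℂ) - lam))) := fun t => by
    have h0 := ofReal_sub_ne_zero_of_im_pos hlam t
    have h1 : (2 * z.re : ℂ) = z + (starRingEnd ℂ) z := by
      rw [Complex.add_conj]
      simp
    rw [h1]
    field_simp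
    linear_combination -hNval t
  calc ∫ t, 1 / ((t : ℂ) - lam) ∂ρ
      = ∫ t, ((t : ℂ) + (lam - 2 * z.re) +
          (lam - z) * (lam - (starRingEnd ℂ) z) * (1 / ((t : ℂ) - lam))) ∂μ := by
        rw [hint]
        exact integral_congr_ae (.of_forall hkey)
    _ = _ := by
        rw [integral_add (f := fun t : ℝ => (t : ℂ) + (lam - 2 * z.re))
            (hid.add (integrable_const _)) (hi.const_mul _),
          integral_add hid (integrable_const _), integral_const, integral_const_mul,
          integral_complex_ofReal]
        push_cast
        rw [Complex.real_smul]
        ring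

/-- One step of the modified Schur algorithm for Markov functions: a Markov
function `φ` of a measure supported in `[α, β]` can be written as
`φ(λ) = -1/(a⁽²⁾λ - a⁽¹⁾ + b²(λ - z)(λ - z̄)τ(λ))` with `τ` the Markov function
of some (possibly zero) finite positive measure supported in `[α, β]`. -/
theorem stmt6 (α β : ℝ) (hαβ : α ≤ β) (σ : Measure ℝ) [IsFiniteMeasure σ]
    (hsupp : σ (Set.Icc α β)ᶜ = 0) (hpos : 0 < σ Set.univ)
    (z : ℂ) (hz : 0 < z.im) :
    ∃ (a₁ a₂ b : ℝ), 0 < b ∧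
      ∃ μ : Measure ℝ, IsFiniteMeasure μ ∧ μ (Set.Icc α β)ᶜ = 0 ∧
        ∀ lam : ℂ, 0 < lam.im →
          ((a₂ : ℂ) * lam - (a₁ : ℂ) +
              (b : ℂ) ^ 2 * (lam - z) * (lam - (starRingEnd ℂ) z) *
                ∫ t, 1 / ((t : ℂ) - lam) ∂μ) ≠ 0 ∧
          (∫ t, 1 / ((t : ℂ) - lam) ∂σ) =
            -1 / ((a₂ : ℂ) * lam - (a₁ : ℂ) +
              (b : ℂ) ^ 2 * (lam - z) * (lam - (starRingEnd ℂ) z) *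
                ∫ t, 1 / ((t : ℂ) - lam) ∂μ) := by
  obtain ⟨s, ρ, hρfin, hρ, hσρ⟩ := exists_measure_markov_mul hαβ σ hsupp
  obtain ⟨c, d, μ, hμfin, hμ, hρμ⟩ := exists_measure_markov_eq ρ hρ hz
  set m : ℝ := σ.real Set.univ
  have hmpos : 0 < m := ENNReal.toReal_pos hpos.ne' (measure_ne_top σ _)
  have hm0 : (m : ℂ) ≠ 0 := Complex.ofReal_ne_zero.2 hmpos.ne'
  refine ⟨(s + d) / m ^ 2, (m + c) / m ^ 2, 1 / m, by positivity, μ, hμfin, hμ, fun lam hlam => ?_⟩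
  have h := hσρ lam hlam
  rw [hρμ lam hlam] at h
  set τ := ∫ t, 1 / ((t : ℂ) - lam) ∂μ
  set φ := ∫ t, 1 / ((t : ℂ) - lam) ∂σ
  have hmul : φ * (((m + c) / m ^ 2 : ℝ) * lam - ((s + d) / m ^ 2 : ℝ) +
      ((1 / m : ℝ) : ℂ) ^ 2 * (lam - z) * (lam - (starRingEnd ℂ) z) * τ) = -1 := by
    push_cast
    field_simp
    linear_combination h
  have hne := right_ne_zero_of_mul (hmul.trans_ne (neg_ne_zero.2 one_ne_zero))
  exact ⟨hne, eq_div_of_mul_eq hne hmul⟩
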